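/- Let φ = C_1 ∧ … ∧ C_m (m ≥ 1) be a CNF formula over variables V such that every clause is non-empty and contains no complementary pair of literals, and let F_φ be its standard translation. Then the argument φ is a stable-facet of F_φ if and only if φ is satisfiable. -/

import Mathlib

def conflictFree {α : Type*} (A : Set α) (R : Set (α × α)) (E : Set α) : Prop :=
  E ⊆ A ∧ ∀ x ∈ E, ∀ y ∈ E, (x, y) ∉ R

def defended {α : Type*} (R : Set (α × α)) (E : Set α) (x : α) : Prop :=
  ∀ y, (y, x) ∈ R → ∃ z ∈ E, (z, y) ∈ R

def admissible {α : Type*} (A : Set α) (R : Set (α × α)) (E : Set α) : Prop :=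
  conflictFree A R E ∧ ∀ x ∈ E, defended R E x

def stable {α : Type*} (A : Set α) (R : Set (α × α)) (E : Set α) : Prop :=
  conflictFree A R E ∧ ∀ x ∈ A, x ∉ E → ∃ y ∈ E, (y, x) ∈ R

def naive {α : Type*} (A : Set α) (R : Set (α × α)) (E : Set α) : Prop :=
  conflictFree A R E ∧ ∀ E', E ⊂ E' → ¬ conflictFree A R E'

def preferred {α : Type*} (A : Set α) (R : Set (α × α)) (E : Set α) : Prop :=
  admissible A R E ∧ ∀ E', E ⊂ E' → ¬ admissible A R E'

def complete {α : Type*} (A : Set α) (R : Set (α × α)) (E : Set α) : Prop :=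
  admissible A R E ∧ ∀ x ∈ A, defended R E x → x ∈ E

def credAccepted {α : Type*} (σ : Set α → Prop) (x : α) : Prop :=
  ∃ E, σ E ∧ x ∈ E

def isFacet {α : Type*} (σ : Set α → Prop) (x : α) : Prop :=
  (∃ E, σ E ∧ x ∈ E) ∧ ¬ ∀ E, σ E → x ∈ E

/-- A literal over variables `V`: a variable or its negation. -/
inductive Lit (V : Type*) where
  | pos (x : V)
  | neg (x : V)
deriving DecidableEq

/-- The complement of a literal. -/
def Lit.compl {V : Type*} : Lit V → Lit V
  | .pos x => .neg x
  | .neg x => .pos x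

/-- Evaluation of a literal under a truth assignment. -/
def Lit.eval {V : Type*} (θ : V → Bool) : Lit V → Bool
  | .pos x => θ x
  | .neg x => !θ x

/-- An assignment satisfies a clause (a finite set of literals). -/
def satClause {V : Type*} (θ : V → Bool) (c : Finset (Lit V)) : Prop :=
  ∃ ℓ ∈ c, Lit.eval θ ℓ = true

/-- An assignment satisfies a CNF with clauses `C 0, …, C (m-1)`. -/
def satCNF {V : Type*} {m : ℕ} (θ : V → Bool) (C : Fin m → Finset (Lit V)) : Prop :=
  ∀ i, satClause θ (C i)

/-- The arguments of the standard translation `F_φ`: the formula argument,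
one argument per clause, and one argument per literal. -/
inductive Arg (V : Type*) (m : ℕ) where
  | fm
  | clause (i : Fin m)
  | lit (ℓ : Lit V)

/-- The attack relation of the standard translation `F_φ`. -/
def attacksOf {V : Type*} {m : ℕ} (C : Fin m → Finset (Lit V)) :
    Set (Arg V m × Arg V m) :=
  {p | (∃ i : Fin m, p = (Arg.clause i, Arg.fm)) ∨
       (∃ ℓ : Lit V, p = (Arg.lit ℓ, Arg.lit ℓ.compl)) ∨
       (∃ i : Fin m, ∃ ℓ ∈ C i, p = (Arg.lit ℓ, Arg.clause i))}

/-- The set of literal arguments made true by the assignment `θ`. -/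
def thetaArgs {V : Type*} (m : ℕ) (θ : V → Bool) : Set (Arg V m) :=
  {x | ∃ ℓ : Lit V, Lit.eval θ ℓ = true ∧ x = Arg.lit ℓ}

def extOf {V : Type*} {m : ℕ} (C : Fin m → Finset (Lit V)) (θ : V → Bool) : Set (Arg V m) :=
  {x | match x with
    | .fm => satCNF θ C
    | .clause i => ¬ satClause θ (C i)
    | .lit ℓ => Lit.eval θ ℓ = true}

theorem eval_compl {V : Type*} (θ : V → Bool) (ℓ : Lit V) :
    Lit.eval θ ℓ.compl = !Lit.eval θ ℓ := by
  cases ℓ <;> simp [Lit.eval, Lit.compl]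

theorem compl_compl_lit {V : Type*} (ℓ : Lit V) : ℓ.compl.compl = ℓ := by
  cases ℓ <;> rfl

theorem stable_extOf {V : Type*} {m : ℕ} (C : Fin m → Finset (Lit V)) (θ : V → Bool) :
    stable Set.univ (attacksOf C) (extOf C θ) := by
  refine ⟨⟨Set.subset_univ _, ?_⟩, ?_⟩
  · rintro x hx y hy (⟨i, h⟩ | ⟨ℓ, h⟩ | ⟨i, ℓ, hl, h⟩) <;>
      (obtain ⟨rfl, rfl⟩ := Prod.mk.inj h)
    · exact hx (hy i)
    · change Lit.eval θ ℓ = true at hx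
      change Lit.eval θ ℓ.compl = true at hy
      rw [eval_compl, hx] at hy
      simp at hy
    · exact hy ⟨ℓ, hl, hx⟩
  · rintro (_ | i | ℓ) - hx
    · change ¬ ∀ i, satClause θ (C i) at hx
      obtain ⟨i, hi⟩ := not_forall.1 hx
      exact ⟨.clause i, hi, Or.inl ⟨i, rfl⟩⟩
    · obtain ⟨ℓ, hl, h⟩ := not_not.1 hx
      exact ⟨.lit ℓ, h, Or.inr (Or.inr ⟨i, ℓ, hl, rfl⟩)⟩
    · change ¬ Lit.eval θ ℓ = true at hx
      refine ⟨.lit ℓ.compl, ?_, Or.inr (Or.inl ⟨ℓ.compl, by rw [compl_compl_lit]⟩)⟩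
      change Lit.eval θ ℓ.compl = true
      rw [eval_compl]
      simpa using hx

/-- For a CNF with at least one clause, all clauses non-empty and without
complementary pairs, the formula argument is a stable-facet of `F_φ`
iff the formula is satisfiable. -/
theorem fm_facet_iff_satisfiable {V : Type*} [Fintype V] [DecidableEq V]
    {m : ℕ} (hm : 1 ≤ m) (C : Fin m → Finset (Lit V))
    (hne : ∀ i, (C i).Nonempty)
    (hnc : ∀ i, ∀ ℓ ∈ C i, ℓ.compl ∉ C i) :
    isFacet (stable Set.univ (attacksOf C)) (Arg.fm : Arg V m) ↔
      ∃ θ : V → Bool, satCNF θ C := by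
  classical
  constructor
  · rintro ⟨⟨E, ⟨⟨-, hcf⟩, hst⟩, hE⟩, -⟩
    refine ⟨fun x => decide (Arg.lit (Lit.pos x) ∈ E), fun i => ?_⟩
    have hi : Arg.clause i ∉ E := fun h => hcf _ h _ hE (Or.inl ⟨i, rfl⟩)
    obtain ⟨y, hy, (⟨j, h⟩ | ⟨ℓ, h⟩ | ⟨j, ℓ, hl, h⟩)⟩ := hst _ trivial hi
    · simp at h
    · simp at h
    · simp only [Prod.mk.injEq, Arg.clause.injEq] at h
      obtain ⟨rfl, rfl⟩ := h
      refine ⟨ℓ, hl, ?_⟩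
      cases ℓ with
      | pos x => simpa [Lit.eval] using hy
      | neg x =>
        have : Arg.lit (Lit.pos x) ∉ E :=
          fun h => hcf _ h _ hy (Or.inr (Or.inl ⟨.pos x, rfl⟩))
        simpa [Lit.eval] using this
  · rintro ⟨θ, hθ⟩
    refine ⟨⟨extOf C θ, stable_extOf C θ, hθ⟩, fun h => ?_⟩
    let i : Fin m := ⟨0, hm⟩
    have h2 : satCNF (fun x => decide (Lit.neg x ∈ C i)) C := h _ (stable_extOf C _)
    obtain ⟨ℓ, hl, he⟩ := h2 i
    cases ℓ with
    | pos x => exact hnc i _ hl (by simpa [Lit.eval, Lit.compl] using he)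
    | neg x => simp [Lit.eval, hl] at he
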